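/- For every α ∈ (0,1/2) and every f ∈ 𝒲₁, the functionals 𝔟 and 𝔠 satisfy the two-sided bounds b'_α ≤ 𝔟(f) ≤ b''_α and (8(1+α)/(3(1−2α)))·c_{0,α}·t₀^{−3/2−α} ≤ 𝔠(f) ≤ c''_{0,α}. -/

import Mathlib

open Real MeasureTheory Set Filter BoundedContinuousFunction

noncomputable section

namespace GSQGhalfplane

/-- The constant `c_{0,α} = 2^{2α-1} Γ(1+α) / (π Γ(1-α))`. -/
def C0 (α : ℝ) : ℝ := (2:ℝ) ^ (2*α - 1) * Real.Gamma (1 + α) / (π * Real.Gamma (1 - α))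

/-- The constant `c'''_{0,α}`. -/
def C3 (α : ℝ) : ℝ :=
  ((4:ℝ) ^ (1 + α) - 4 + α - 4*α^3) * Real.Gamma α /
    (2*π*α*(5 - 2*α)*(3 - 2*α)*(1 - 2*α)*Real.Gamma (2 - α))

/-- The exponent `δ_u = c'''_{0,α} t₀^{1/2-α} / (1 + c'''_{0,α} t₀^{1/2-α})`. -/
def deltaU (α t0 : ℝ) : ℝ :=
  C3 α * t0 ^ (1/2 - α) / (1 + C3 α * t0 ^ (1/2 - α))

/-- The lower barrier `f_l(x) = (1 + t₀^{-2} x²)^{-δ_l}`. -/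
def fl (t0 δl x : ℝ) : ℝ := (1 + x^2 / t0^2) ^ (-δl)

/-- The upper barrier `f_u(x) = min(1, t₀^{δ_u} |x|^{-δ_u})` (with value `1` at `x = 0`). -/
def fu (α t0 x : ℝ) : ℝ :=
  if x = 0 then 1 else min 1 (t0 ^ deltaU α t0 * |x| ^ (-(deltaU α t0)))

/-- The invariant set `𝒲₁`: even continuous bounded functions with `f(0)=1`,
nonnegative and non-increasing on `[0,∞)`, `x ↦ f(√x)` convex,
`f_l ≤ f ≤ f_u`, and left derivative at `t₀` at most `-t₀^{α-3/2}`. -/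
def W1 (α t0 δl : ℝ) (f : ℝ → ℝ) : Prop :=
  Continuous f ∧ (∃ M : ℝ, ∀ x : ℝ, |f x| ≤ M) ∧ (∀ x : ℝ, f (-x) = f x) ∧
  f 0 = 1 ∧ (∀ x ∈ Ici (0:ℝ), 0 ≤ f x) ∧ AntitoneOn f (Ici (0:ℝ)) ∧
  ConvexOn ℝ (Ici (0:ℝ)) (fun x => f (Real.sqrt x)) ∧
  (∀ x : ℝ, fl t0 δl x ≤ f x) ∧ (∀ x : ℝ, f x ≤ fu α t0 x) ∧
  (∃ d : ℝ, HasDerivWithinAt f d (Iio t0) t0 ∧ d ≤ -(t0 ^ (α - 3/2)))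

/-- The linear operator `𝔗_α(f)`, defined for `x > 0`, set to `0` at `x = 0`,
and extended evenly to `ℝ` (via `|x|`). -/
def Tfr (α : ℝ) (f : ℝ → ℝ) (x : ℝ) : ℝ :=
  if x = 0 then 0
  else (C0 α / α) * ∫ ξ in Ioi (0:ℝ),
    f ξ * (4*α * ξ ^ (-(2*α)) - (ξ / |x|) * (|(|x| - ξ)| ^ (-(2*α)) - (|x| + ξ) ^ (-(2*α))))

/-- The nonlinear map `ℜ_α(f)(x) = exp(-∫₀^{|x|} 𝔗_α(f)(y)/(y(1+𝔗_α(f)(y))) dy)`. -/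
def Rfr (α : ℝ) (f : ℝ → ℝ) (x : ℝ) : ℝ :=
  Real.exp (-(∫ y in (0:ℝ)..|x|, Tfr α f y / (y * (1 + Tfr α f y))))

/-- The functional `𝔟(f) = 4 c_{0,α} ∫₀^∞ f(ξ) ξ^{-2α} dξ`. -/
def bfr (α : ℝ) (f : ℝ → ℝ) : ℝ := 4 * C0 α * ∫ ξ in Ioi (0:ℝ), f ξ * ξ ^ (-(2*α))

/-- The functional `𝔠(f) = (8(1+2α)(1+α)/3) c_{0,α} ∫₀^∞ (1-f(ξ)) ξ^{-2-2α} dξ`. -/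
def cfr (α : ℝ) (f : ℝ → ℝ) : ℝ :=
  (8*(1+2*α)*(1+α)/3) * C0 α * ∫ ξ in Ioi (0:ℝ), (1 - f ξ) * ξ ^ (-2 - 2*α)

/-- The lower bound `b'_α`. -/
def bLow (α t0 δl : ℝ) : ℝ :=
  2 * C0 α * t0 ^ (1 - 2*α) * Real.Gamma (1/2 - α) * Real.Gamma (α + δl - 1/2) /
    Real.Gamma δl

/-- The upper bound `b''_α`. -/
def bHigh (α t0 : ℝ) : ℝ :=
  4 * C0 α * t0 ^ (1 - 2*α) * (1/(1 - 2*α) + 1/(deltaU α t0 + 2*α - 1))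

/-- The upper bound `c''_{0,α}`. -/
def cHigh (α t0 δl : ℝ) : ℝ :=
  C0 α * t0 ^ (-1 - 2*α) * 8 * (1 + α) * Real.Gamma (1/2 - α) *
    Real.Gamma (δl + α + 1/2) / (3 * Real.Gamma δl)

open scoped Topology

open ProbabilityTheory in
lemma integral_rpow_mul_one_sub_rpow {a b : ℝ} (ha : 0 < a) (hb : 0 < b) :
    ∫ x in Ioo (0:ℝ) 1, x ^ (a - 1) * (1 - x) ^ (b - 1) = beta a b := by
  have h := lintegral_betaPDF_eq_one ha hb
  rw [lintegral_betaPDF] at h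
  have h2 : ∫ x in Ioo (0:ℝ) 1, (1 / beta a b * x ^ (a - 1) * (1 - x) ^ (b - 1)) = 1 := by
    rw [integral_eq_lintegral_of_nonneg_ae, h, ENNReal.toReal_one]
    · refine ae_restrict_of_forall_mem measurableSet_Ioo fun x hx => ?_
      have := beta_pos ha hb
      have := hx.1
      have : 0 < 1 - x := sub_pos.2 hx.2
      simp only [Pi.zero_apply]
      positivity
    · exact Measurable.aestronglyMeasurable (by fun_prop)
  simp_rw [mul_assoc, integral_const_mul] at h2
  have := (beta_pos ha hb).ne'
  field_simp at h2
  exact h2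

open ProbabilityTheory in
lemma integral_rpow_mul_one_add_sq_rpow {a b : ℝ} (ha : 0 < a) (hb : 0 < b) :
    ∫ u in Ioi (0:ℝ), u ^ (2 * a - 1) * (1 + u ^ 2) ^ (-(a + b)) = beta a b / 2 := by
  have himg : (fun u : ℝ => u ^ 2 / (1 + u ^ 2)) '' Ioi 0 = Ioo 0 1 := by
    ext x
    simp only [mem_image, mem_Ioi, mem_Ioo]
    constructor
    · rintro ⟨u, hu, rfl⟩
      exact ⟨by positivity, by rw [div_lt_one (by positivity)]; linarith⟩
    · rintro ⟨h0, h1⟩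
      have h2 : 0 < 1 - x := sub_pos.2 h1
      refine ⟨√(x / (1 - x)), Real.sqrt_pos.2 (by positivity), ?_⟩
      rw [Real.sq_sqrt (by positivity)]
      field_simp
      ring
  have hinj : InjOn (fun u : ℝ => u ^ 2 / (1 + u ^ 2)) (Ioi 0) := by
    intro u hu v hv huv
    rw [mem_Ioi] at hu hv
    simp only at huv
    rw [div_eq_div_iff (by positivity) (by positivity)] at huv
    have : u ^ 2 = v ^ 2 := by linarith
    exact (sq_eq_sq₀ hu.le hv.le).1 this
  have hder : ∀ u ∈ Ioi (0:ℝ), HasDerivWithinAt (fun u : ℝ => u ^ 2 / (1 + u ^ 2))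
      (2 * u / (1 + u ^ 2) ^ 2) (Ioi 0) u := by
    intro u _
    have h1 : HasDerivAt (fun u : ℝ => u ^ 2) (2 * u) u := by simpa using hasDerivAt_pow 2 u
    have := h1.div (h1.const_add 1) (by positivity)
    refine (this.congr_deriv ?_).hasDerivWithinAt
    ring
  have key := integral_image_eq_integral_abs_deriv_smul measurableSet_Ioi hder hinj
    (fun x => x ^ (a - 1) * (1 - x) ^ (b - 1))
  rw [himg, integral_rpow_mul_one_sub_rpow ha hb] at key
  rw [key, eq_div_iff two_ne_zero, ← integral_mul_const]
  refine setIntegral_congr_fun measurableSet_Ioi fun u (hu : 0 < u) => ?_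
  have h1 : (0:ℝ) < 1 + u ^ 2 := by positivity
  have h2 : 1 - u ^ 2 / (1 + u ^ 2) = (1 + u ^ 2)⁻¹ := by field_simp; ring
  simp only [smul_eq_mul]
  rw [h2, abs_of_pos (by positivity), Real.div_rpow (by positivity) h1.le, ← Real.rpow_natCast u 2,
    ← Real.rpow_mul hu.le, Real.inv_rpow (by positivity)]
  rw [show 2 * a - 1 = ((2:ℕ):ℝ) * (a - 1) + 1 by push_cast; ring, Real.rpow_add_one hu.ne',
    show -(a + b) = -(a-1) - (b - 1) - (2:ℕ) by push_cast; ring, Real.rpow_sub (by positivity),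
    Real.rpow_sub (by positivity), Real.rpow_neg (by positivity), Real.rpow_natCast (1 + _) 2]
  field_simp

open ProbabilityTheory in
lemma integral_rpow_mul_one_add_sq_div_rpow {a b t : ℝ} (ha : 0 < a) (hb : 0 < b) (ht : 0 < t) :
    ∫ x in Ioi (0:ℝ), x ^ (2 * a - 1) * (1 + x ^ 2 / t ^ 2) ^ (-(a + b)) =
      t ^ (2 * a) * (beta a b / 2) := by
  have h := integral_comp_mul_left_Ioi'
    (fun x : ℝ => x ^ (2 * a - 1) * (1 + x ^ 2 / t ^ 2) ^ (-(a + b))) 0 ht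
  rw [mul_zero] at h
  rw [← h, ← integral_rpow_mul_one_add_sq_rpow ha hb, smul_eq_mul, ← integral_const_mul,
    ← integral_const_mul]
  refine setIntegral_congr_fun measurableSet_Ioi fun u (hu : 0 < u) => ?_
  rw [Real.mul_rpow ht.le hu.le, mul_pow, mul_div_assoc, mul_div_cancel₀ _ (by positivity),
    Real.rpow_sub_one ht.ne']
  field_simp

open ProbabilityTheory in
lemma integrableOn_rpow_mul_one_add_sq_div_rpow {a b t : ℝ} (ha : 0 < a) (hb : 0 < b)
    (ht : 0 < t) :
    IntegrableOn (fun x : ℝ => x ^ (2 * a - 1) * (1 + x ^ 2 / t ^ 2) ^ (-(a + b))) (Ioi 0) := by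
  refine Integrable.of_integral_ne_zero ?_
  rw [integral_rpow_mul_one_add_sq_div_rpow ha hb ht]
  have := beta_pos ha hb
  positivity

lemma setIntegral_Ioc_zero_rpow {p t : ℝ} (hp : -1 < p) (ht : 0 < t) :
    ∫ x in Ioc 0 t, x ^ p = t ^ (p + 1) / (p + 1) := by
  rw [← intervalIntegral.integral_of_le ht.le, integral_rpow (Or.inl hp),
    Real.zero_rpow (by linarith), sub_zero]

lemma integrableOn_Ioc_zero_rpow {p t : ℝ} (hp : -1 < p) (ht : 0 < t) :
    IntegrableOn (fun x : ℝ => x ^ p) (Ioc 0 t) :=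
  (intervalIntegrable_iff_integrableOn_Ioc_of_le ht.le).1
    (intervalIntegral.intervalIntegrable_rpow' hp)

/-- A function squeezed between `0` and a pair of power functions is integrable, and its integral
is at most that of the powers. -/
lemma integrableOn_and_integral_le_of_le_rpow {h : ℝ → ℝ} {A B p q t : ℝ} (hp : -1 < p)
    (hq : q < -1) (ht : 0 < t) (hm : AEStronglyMeasurable h (volume.restrict (Ioi 0)))
    (h0 : ∀ x, 0 < x → 0 ≤ h x) (h1 : ∀ x, 0 < x → x ≤ t → h x ≤ A * x ^ p)
    (h2 : ∀ x, t < x → h x ≤ B * x ^ q) :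
    IntegrableOn h (Ioi 0) ∧
      ∫ x in Ioi 0, h x ≤ A * (t ^ (p + 1) / (p + 1)) + B * (-t ^ (q + 1) / (q + 1)) := by
  have hU := Ioc_union_Ioi_eq_Ioi ht.le
  have i1 : IntegrableOn (fun x : ℝ => A * x ^ p) (Ioc 0 t) :=
    (integrableOn_Ioc_zero_rpow hp ht).const_mul A
  have i2 : IntegrableOn (fun x : ℝ => B * x ^ q) (Ioi t) :=
    (integrableOn_Ioi_rpow_of_lt hq ht).const_mul B
  have j1 : IntegrableOn h (Ioc 0 t) := by
    refine Integrable.mono' i1 (hm.mono_set Ioc_subset_Ioi_self) ?_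
    refine ae_restrict_of_forall_mem measurableSet_Ioc fun x hx => ?_
    rw [Real.norm_of_nonneg (h0 x hx.1)]
    exact h1 x hx.1 hx.2
  have j2 : IntegrableOn h (Ioi t) := by
    refine Integrable.mono' i2 (hm.mono_set (Ioi_subset_Ioi ht.le)) ?_
    refine ae_restrict_of_forall_mem measurableSet_Ioi fun x hx => ?_
    rw [Real.norm_of_nonneg (h0 x (ht.trans hx))]
    exact h2 x hx
  refine ⟨hU ▸ j1.union j2, ?_⟩
  rw [← hU, setIntegral_union (Ioc_disjoint_Ioi le_rfl) measurableSet_Ioi j1 j2,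
    ← setIntegral_Ioc_zero_rpow hp ht, ← integral_Ioi_rpow_of_lt hq ht, ← integral_const_mul,
    ← integral_const_mul]
  exact add_le_add (setIntegral_mono_on j1 i1 measurableSet_Ioc fun x hx => h1 x hx.1 hx.2)
    (setIntegral_mono_on j2 i2 measurableSet_Ioi fun x hx => h2 x hx)

lemma le_integral_of_rpow_le {h : ℝ → ℝ} {A B p q t : ℝ} (hp : -1 < p) (hq : q < -1) (ht : 0 < t)
    (hi : IntegrableOn h (Ioi 0)) (h1 : ∀ x, 0 < x → x ≤ t → A * x ^ p ≤ h x)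
    (h2 : ∀ x, t < x → B * x ^ q ≤ h x) :
    A * (t ^ (p + 1) / (p + 1)) + B * (-t ^ (q + 1) / (q + 1)) ≤ ∫ x in Ioi 0, h x := by
  have hU := Ioc_union_Ioi_eq_Ioi ht.le
  have i1 : IntegrableOn (fun x : ℝ => A * x ^ p) (Ioc 0 t) :=
    (integrableOn_Ioc_zero_rpow hp ht).const_mul A
  have i2 : IntegrableOn (fun x : ℝ => B * x ^ q) (Ioi t) :=
    (integrableOn_Ioi_rpow_of_lt hq ht).const_mul B
  have j1 : IntegrableOn h (Ioc 0 t) := hi.mono_set Ioc_subset_Ioi_self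
  have j2 := hi.mono_set (Ioi_subset_Ioi ht.le)
  rw [← hU, setIntegral_union (Ioc_disjoint_Ioi le_rfl) measurableSet_Ioi j1 j2,
    ← setIntegral_Ioc_zero_rpow hp ht, ← integral_Ioi_rpow_of_lt hq ht, ← integral_const_mul,
    ← integral_const_mul]
  exact add_le_add (setIntegral_mono_on i1 j1 measurableSet_Ioc fun x hx => h1 x hx.1 hx.2)
    (setIntegral_mono_on i2 j2 measurableSet_Ioi fun x hx => h2 x hx)

lemma fl_nonneg (t δ x : ℝ) : 0 ≤ fl t δ x := by
  unfold fl; positivity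

lemma fl_le_one {t δ : ℝ} (hδ : 0 ≤ δ) (x : ℝ) : fl t δ x ≤ 1 :=
  Real.rpow_le_one_of_one_le_of_nonpos (le_add_of_nonneg_right (by positivity)) (by linarith)

lemma one_sub_fl_le {t δ : ℝ} (hδ : 0 ≤ δ) (x : ℝ) : 1 - fl t δ x ≤ δ / t ^ 2 * x ^ 2 := by
  have h1 : (0:ℝ) < 1 + x ^ 2 / t ^ 2 := by positivity
  have h2 : Real.log (1 + x ^ 2 / t ^ 2) ≤ x ^ 2 / t ^ 2 := by
    linarith [Real.log_le_sub_one_of_pos h1]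
  have h3 : -(δ * (x ^ 2 / t ^ 2)) + 1 ≤ fl t δ x := by
    rw [fl, Real.rpow_def_of_pos h1]
    refine (Real.add_one_le_exp _).trans (Real.exp_le_exp.2 ?_)
    nlinarith [mul_le_mul_of_nonneg_left h2 hδ]
  calc 1 - fl t δ x ≤ δ * (x ^ 2 / t ^ 2) := by linarith
    _ = _ := by ring

lemma continuous_fl (t δ : ℝ) : Continuous (fl t δ) := by
  unfold fl
  refine Continuous.rpow_const (by fun_prop) fun x => Or.inl ?_
  positivity

lemma integrableOn_one_sub_fl_mul_rpow {α t δ : ℝ} (hα : 0 < α) (hα' : α < 1 / 2) (hδ : 0 ≤ δ) :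
    IntegrableOn (fun x : ℝ => (1 - fl t δ x) * x ^ (-2 - 2 * α)) (Ioi 0) := by
  refine (integrableOn_and_integral_le_of_le_rpow (A := δ / t ^ 2) (B := 1) (p := -(2 * α))
    (q := -2 - 2 * α) (t := 1) (by linarith) (by linarith) one_pos ?_ ?_ ?_ ?_).1
  · exact ((measurable_const.sub (continuous_fl t δ).measurable).mul
      (by fun_prop)).aestronglyMeasurable
  · intro x hx
    exact mul_nonneg (sub_nonneg.2 (fl_le_one hδ x)) (by positivity)
  · intro x hx _
    rw [show -(2 * α) = -2 - 2 * α + (2 : ℕ) by push_cast; ring, Real.rpow_add_natCast hx.ne',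
      mul_comm (x ^ _), ← mul_assoc]
    exact mul_le_mul_of_nonneg_right (one_sub_fl_le hδ x) (by positivity)
  · intro x hx
    have : 0 < x := one_pos.trans hx
    exact mul_le_mul_of_nonneg_right (by linarith [fl_nonneg t δ x]) (by positivity)

lemma integral_one_sub_fl_mul_rpow {α t δ : ℝ} (hα : 0 < α) (hα' : α < 1 / 2) (hδ : 0 < δ)
    (ht : 0 < t) :
    ∫ x in Ioi (0:ℝ), (1 - fl t δ x) * x ^ (-2 - 2 * α) =
      2 * δ / t ^ 2 / (1 + 2 * α) *
        ∫ x in Ioi (0:ℝ), x ^ (-(2 * α)) * (1 + x ^ 2 / t ^ 2) ^ (-(δ + 1)) := by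
  have hB := integrableOn_one_sub_fl_mul_rpow (t := t) hα hα' hδ.le
  have hA : IntegrableOn (fun x : ℝ => x ^ (-(2 * α)) * (1 + x ^ 2 / t ^ 2) ^ (-(δ + 1)))
      (Ioi 0) := by
    have := integrableOn_rpow_mul_one_add_sq_div_rpow (a := 1 / 2 - α) (b := δ + α + 1 / 2)
      (by linarith) (by linarith) ht
    convert this using 4 <;> ring
  have hderiv : ∀ x ∈ Ioi (0:ℝ), HasDerivAt (fun x => (1 - fl t δ x) * x ^ (-1 - 2 * α))
      (2 * δ / t ^ 2 * (x ^ (-(2 * α)) * (1 + x ^ 2 / t ^ 2) ^ (-(δ + 1))) -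
        (1 + 2 * α) * ((1 - fl t δ x) * x ^ (-2 - 2 * α))) x := by
    intro x (hx : 0 < x)
    have h1 : HasDerivAt (fun x : ℝ => 1 + x ^ 2 / t ^ 2) (2 * x / t ^ 2) x := by
      simpa using ((hasDerivAt_pow 2 x).div_const (t ^ 2)).const_add 1
    have h2 := (h1.rpow_const (p := -δ) (Or.inl (by positivity))).const_sub 1
    have h3 := h2.mul (Real.hasDerivAt_rpow_const (x := x) (p := -1 - 2 * α) (Or.inl hx.ne'))
    refine h3.congr_deriv ?_
    rw [show -1 - 2 * α - 1 = -2 - 2 * α by ring, show -δ - 1 = -(δ + 1) by ring,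
      show -(2 * α) = -1 - 2 * α + 1 by ring, Real.rpow_add_one hx.ne']
    unfold fl
    ring
  have hzero : ContinuousWithinAt (fun x => (1 - fl t δ x) * x ^ (-1 - 2 * α)) (Ici 0) 0 := by
    have hF0 : (1 - fl t δ 0) * (0:ℝ) ^ (-1 - 2 * α) = 0 := by simp [fl]
    rw [ContinuousWithinAt, hF0]
    have hlim : Tendsto (fun x : ℝ => δ / t ^ 2 * x ^ (1 - 2 * α)) (𝓝[≥] 0) (𝓝 0) := by
      have : ContinuousAt (fun x : ℝ => δ / t ^ 2 * x ^ (1 - 2 * α)) 0 :=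
        continuousAt_const.mul (Real.continuousAt_rpow_const _ _ (Or.inr (by linarith)))
      have := this.tendsto
      rw [Real.zero_rpow (by linarith), mul_zero] at this
      exact this.mono_left nhdsWithin_le_nhds
    refine tendsto_of_tendsto_of_tendsto_of_le_of_le' tendsto_const_nhds hlim ?_ ?_
    · filter_upwards [self_mem_nhdsWithin] with x (hx : 0 ≤ x)
      exact mul_nonneg (sub_nonneg.2 (fl_le_one hδ.le x)) (by positivity)
    · filter_upwards [self_mem_nhdsWithin] with x (hx : 0 ≤ x)
      rcases hx.eq_or_lt with rfl | hx
      · rw [hF0]; positivity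
      · rw [show 1 - 2 * α = -1 - 2 * α + (2 : ℕ) by push_cast; ring,
          Real.rpow_add_natCast hx.ne', mul_comm (x ^ _), ← mul_assoc]
        exact mul_le_mul_of_nonneg_right (one_sub_fl_le hδ.le x) (by positivity)
  have htop : Tendsto (fun x => (1 - fl t δ x) * x ^ (-1 - 2 * α)) atTop (𝓝 0) := by
    have hlim : Tendsto (fun x : ℝ => x ^ (-1 - 2 * α)) atTop (𝓝 0) := by
      rw [show -1 - 2 * α = -(1 + 2 * α) by ring]
      exact tendsto_rpow_neg_atTop (by linarith)
    refine tendsto_of_tendsto_of_tendsto_of_le_of_le' tendsto_const_nhds hlim ?_ ?_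
    · filter_upwards [eventually_gt_atTop 0] with x hx
      exact mul_nonneg (sub_nonneg.2 (fl_le_one hδ.le x)) (by positivity)
    · filter_upwards [eventually_gt_atTop 0] with x hx
      exact mul_le_of_le_one_left (by positivity) (by linarith [fl_nonneg t δ x])
  have hint := integral_Ioi_of_hasDerivAt_of_tendsto hzero hderiv
    ((hA.const_mul _).sub (hB.const_mul _)) htop
  rw [integral_sub (hA.const_mul _) (hB.const_mul _), integral_const_mul, integral_const_mul] at hint
  have : fl t δ 0 = 1 := by simp [fl]
  rw [this] at hint
  have hne : 1 + 2 * α ≠ 0 := by positivity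
  rw [div_mul_eq_mul_div, eq_div_iff hne]
  linarith

/-- If `x ↦ f (√x)` is convex and the left derivative of `f` at `t` is `d`, the chord of
`x ↦ f (√x)` over `[0, t²]` has slope at most `d / (2 t)`. -/
lemma sub_le_of_convexOn_comp_sqrt {f : ℝ → ℝ} {d t : ℝ} (ht : 0 < t)
    (hc : ConvexOn ℝ (Ici (0:ℝ)) (fun x => f (√x))) (hd : HasDerivWithinAt f d (Iio t) t) :
    f t - f 0 ≤ d * t / 2 := by
  have hslope := hasDerivWithinAt_iff_tendsto_slope' (s := Iio t) (by simp) |>.1 hd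
  have hlim : Tendsto (fun x => slope f t x / (t + x) * t ^ 2) (𝓝[<] t)
      (𝓝 (d / (t + t) * t ^ 2)) := by
    refine (hslope.div ?_ (by positivity)).mul_const _
    exact ((continuous_const.add continuous_id).tendsto t).mono_left nhdsWithin_le_nhds
  have heq : d / (t + t) * t ^ 2 = d * t / 2 := by field_simp; ring
  rw [heq] at hlim
  refine ge_of_tendsto hlim ?_
  filter_upwards [Ioo_mem_nhdsLT ht] with x hx
  have hx0 : 0 < x := hx.1
  have hxt : x < t := hx.2
  have h2 : x ^ 2 < t ^ 2 := by gcongr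
  have := hc.secant_mono (a := t ^ 2) (x := 0) (y := x ^ 2) (mem_Ici.2 (by positivity))
    (mem_Ici.2 le_rfl) (mem_Ici.2 (by positivity)) (by positivity) h2.ne (by positivity)
  simp only [Real.sqrt_sq ht.le, Real.sqrt_sq hx0.le, Real.sqrt_zero] at this
  have hne : x - t ≠ 0 := (sub_neg.2 hxt).ne
  have e1 : slope f t x / (t + x) = (f x - f t) / (x ^ 2 - t ^ 2) := by
    rw [slope_def_field, div_div]; congr 1; ring
  rw [e1]
  have e2 : f t - f 0 = (f 0 - f t) / (0 - t ^ 2) * t ^ 2 := by field_simp; ring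
  rw [e2]
  gcongr

lemma le_of_convexOn_comp_sqrt {f : ℝ → ℝ} {t x : ℝ} (ht : 0 < t)
    (hc : ConvexOn ℝ (Ici (0:ℝ)) (fun x => f (√x))) (hx : 0 < x) (hxt : x ≤ t) :
    f x - f 0 ≤ (f t - f 0) / t ^ 2 * x ^ 2 := by
  have := hc.secant_mono (a := 0) (x := x ^ 2) (y := t ^ 2) (mem_Ici.2 le_rfl)
    (mem_Ici.2 (by positivity)) (mem_Ici.2 (by positivity)) (by positivity) (by positivity)
    (by gcongr)
  simp only [Real.sqrt_sq ht.le, Real.sqrt_sq hx.le, Real.sqrt_zero, sub_zero] at this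
  exact (div_le_iff₀ (by positivity)).1 this

lemma C0_pos {α : ℝ} (hα : 0 < α) (hα' : α < 1 / 2) : 0 < C0 α := by
  have := Real.Gamma_pos_of_pos (show 0 < 1 + α by linarith)
  have := Real.Gamma_pos_of_pos (show 0 < 1 - α by linarith)
  unfold C0
  positivity

lemma C3_pos {α : ℝ} (hα : 0 < α) (hα' : α < 1 / 2) : 0 < C3 α := by
  have := Real.Gamma_pos_of_pos hα
  have := Real.Gamma_pos_of_pos (show 0 < 2 - α by linarith)
  have h4 : (4:ℝ) ≤ 4 ^ (1 + α) := by
    simpa using Real.rpow_le_rpow_of_exponent_le (show (1:ℝ) ≤ 4 by norm_num)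
      (show 1 ≤ 1 + α by linarith)
  have hnum : 0 < (4:ℝ) ^ (1 + α) - 4 + α - 4 * α ^ 3 := by
    nlinarith [mul_pos hα (show 0 < 1 - 4 * α ^ 2 by nlinarith)]
  have : 0 < 5 - 2 * α := by linarith
  have : 0 < 3 - 2 * α := by linarith
  have : 0 < 1 - 2 * α := by linarith
  unfold C3
  positivity

lemma lt_deltaU {α t : ℝ} (hα : 0 < α) (hα' : α < 1 / 2) (ht : 0 < t)
    (h : (1 - 2 * α) / (2 * α * C3 α) < t ^ (1 / 2 - α)) : 1 - 2 * α < deltaU α t := by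
  have hC := C3_pos hα hα'
  rw [div_lt_iff₀ (by positivity)] at h
  have : 0 < t ^ (1 / 2 - α) := by positivity
  rw [deltaU, lt_div_iff₀ (by positivity)]
  linarith

lemma integral_rpow_mul_le_of_le_fu {α t : ℝ} {f : ℝ → ℝ} (hα' : α < 1 / 2)
    (ht : 0 < t) (hδ : 1 - 2 * α < deltaU α t) (hf : Continuous f) (hf0 : ∀ x ∈ Ici (0:ℝ), 0 ≤ f x)
    (hfu : ∀ x, f x ≤ fu α t x) :
    IntegrableOn (fun x => f x * x ^ (-(2 * α))) (Ioi 0) ∧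
      ∫ x in Ioi (0:ℝ), f x * x ^ (-(2 * α)) ≤
        t ^ (1 - 2 * α) * (1 / (1 - 2 * α) + 1 / (deltaU α t + 2 * α - 1)) := by
  have h := integrableOn_and_integral_le_of_le_rpow (h := fun x => f x * x ^ (-(2 * α)))
    (A := 1) (B := t ^ deltaU α t) (p := -(2 * α)) (q := -deltaU α t - 2 * α) (t := t)
    (by linarith) (by linarith) ht (hf.measurable.mul (by fun_prop)).aestronglyMeasurable
    (fun x hx => mul_nonneg (hf0 x hx.le) (by positivity)) ?_ ?_
  · refine ⟨h.1, h.2.trans_eq ?_⟩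
    have e : t ^ (1 - 2 * α) = t ^ deltaU α t * t ^ (-deltaU α t - 2 * α + 1) := by
      rw [← Real.rpow_add ht]; congr 1; ring
    have e2 : -t ^ (-deltaU α t - 2 * α + 1) / (-deltaU α t - 2 * α + 1) =
        t ^ (-deltaU α t - 2 * α + 1) * (1 / (deltaU α t + 2 * α - 1)) := by
      rw [show -deltaU α t - 2 * α + 1 = -(deltaU α t + 2 * α - 1) by ring, neg_div_neg_eq]
      ring
    rw [e2, mul_add, ← mul_assoc, ← e, show -(2 * α) + 1 = 1 - 2 * α by ring]
    ring
  · intro x hx _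
    have := hfu x
    rw [fu, if_neg hx.ne'] at this
    exact mul_le_mul_of_nonneg_right (this.trans (min_le_left _ _)) (by positivity)
  · intro x hx
    have hx0 := ht.trans hx
    have := hfu x
    rw [fu, if_neg hx0.ne', abs_of_pos hx0] at this
    rw [sub_eq_add_neg, Real.rpow_add hx0, ← mul_assoc]
    exact mul_le_mul_of_nonneg_right (this.trans (min_le_right _ _)) (by positivity)

/-- Two-sided bounds for the functionals `𝔟` and `𝔠` on `𝒲₁`. -/
theorem bfr_cfr_bounds (α t0 δl : ℝ) (hα : α ∈ Ioo (0:ℝ) (1/2)) (ht0 : 1 < t0)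
    (ht1 : max (1 / C3 α) ((1 - 2*α) / (2*α * C3 α)) < t0 ^ (1/2 - α))
    (ht2 : (2:ℝ) ^ ((2:ℝ) ^ α + 2) * Real.Gamma (2 + α) * Real.Gamma (1/2 - α) /
        (3*π*α*Real.Gamma (1 - α)) < t0 ^ (1/2 + α))
    (hδl : 1/2 ≤ δl)
    (hδ1 : (2:ℝ) ^ (2*α) * Real.Gamma (2 + α) * Real.Gamma (1/2 - α) /
        (3*π*Real.Gamma (1 - α)) ≤
        Real.Gamma (δl + 1) * t0 ^ (2*α - 1) / Real.Gamma (δl + α + 1/2))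
    (hδ2 : Real.Gamma (δl + 1) * t0 ^ (2*α - 1) / Real.Gamma (δl + α + 1/2) ≤
        (2:ℝ) ^ (2*α + 1) * Real.Gamma (2 + α) * Real.Gamma (1/2 - α) /
        (3*π*Real.Gamma (1 - α)))
    (f : ℝ → ℝ) (hf : W1 α t0 δl f) :
    bLow α t0 δl ≤ bfr α f ∧ bfr α f ≤ bHigh α t0 ∧
    (8*(1+α)/(3*(1 - 2*α))) * C0 α * t0 ^ (-3/2 - α) ≤ cfr α f ∧
    cfr α f ≤ cHigh α t0 δl := by
  obtain ⟨hα0, hα1⟩ := hα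
  obtain ⟨hcont, -, -, hf0, hpos, hanti, hconv, hfl, hfu, d, hd, hdle⟩ := hf
  have ht : 0 < t0 := one_pos.trans ht0
  have hδ : 0 < δl := by linarith
  have hC := C0_pos hα0 hα1
  obtain ⟨hbi, hbu⟩ := integral_rpow_mul_le_of_le_fu hα1 ht
    (lt_deltaU hα0 hα1 ht ((le_max_right _ _).trans_lt ht1)) hcont hpos hfu
  have hfle : ∀ x, 0 < x → f x ≤ 1 := fun x hx =>
    hf0 ▸ hanti (mem_Ici.2 le_rfl) (mem_Ici.2 hx.le) hx.le
  have hc1 := integrableOn_one_sub_fl_mul_rpow (t := t0) hα0 hα1 hδ.le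
  have hle : ∀ x ∈ Ioi (0:ℝ), (1 - f x) * x ^ (-2 - 2 * α) ≤
      (1 - fl t0 δl x) * x ^ (-2 - 2 * α) := fun x (hx : 0 < x) =>
    mul_le_mul_of_nonneg_right (by linarith [hfl x]) (by positivity)
  have hci : IntegrableOn (fun x => (1 - f x) * x ^ (-2 - 2 * α)) (Ioi 0) := by
    refine Integrable.mono' hc1 ((measurable_const.sub hcont.measurable).mul
      (by fun_prop)).aestronglyMeasurable ?_
    refine ae_restrict_of_forall_mem measurableSet_Ioi fun x hx => ?_
    rw [Real.norm_of_nonneg]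
    · exact hle x hx
    · exact mul_nonneg (sub_nonneg.2 (hfle x hx)) (Real.rpow_nonneg (le_of_lt hx) _)
  have hΓ : Real.Gamma (δl + 1) = δl * Real.Gamma δl := Real.Gamma_add_one hδ.ne'
  have hΓ0 := Real.Gamma_pos_of_pos hδ
  refine ⟨?_, ?_, ?_, ?_⟩
  · have hmono : ∫ x in Ioi (0:ℝ), x ^ (2 * (1 / 2 - α) - 1) *
        (1 + x ^ 2 / t0 ^ 2) ^ (-(1 / 2 - α + (α + δl - 1 / 2))) ≤
        ∫ x in Ioi (0:ℝ), f x * x ^ (-(2 * α)) := by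
      refine setIntegral_mono_on (integrableOn_rpow_mul_one_add_sq_div_rpow (by linarith)
        (by linarith) ht) hbi measurableSet_Ioi fun x (hx : 0 < x) => ?_
      rw [mul_comm (f x), show 2 * (1 / 2 - α) - 1 = -(2 * α) by ring,
        show 1 / 2 - α + (α + δl - 1 / 2) = δl by ring]
      exact mul_le_mul_of_nonneg_left (hfl x) (by positivity)
    rw [integral_rpow_mul_one_add_sq_div_rpow (by linarith) (by linarith) ht,
      ProbabilityTheory.beta, show 1 / 2 - α + (α + δl - 1 / 2) = δl by ring,
      show 2 * (1 / 2 - α) = 1 - 2 * α by ring] at hmono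
    refine le_trans (le_of_eq ?_) (mul_le_mul_of_nonneg_left hmono
      (show 0 ≤ 4 * C0 α by positivity))
    unfold bLow
    ring
  · refine (mul_le_mul_of_nonneg_left hbu (show 0 ≤ 4 * C0 α by positivity)).trans_eq ?_
    unfold bHigh
    ring
  · have hchord := sub_le_of_convexOn_comp_sqrt ht hconv hd
    rw [hf0] at hchord
    have hdrop : t0 ^ (α - 1 / 2) / 2 ≤ 1 - f t0 := by
      have e : t0 ^ (α - 1 / 2) = t0 ^ (α - 3 / 2) * t0 := by
        rw [← Real.rpow_add_one ht.ne']; congr 1; ring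
      rw [e]
      nlinarith [mul_le_mul_of_nonneg_right hdle ht.le]
    have hlow := le_integral_of_rpow_le (A := t0 ^ (α - 1 / 2) / 2 / t0 ^ 2)
      (B := t0 ^ (α - 1 / 2) / 2) (p := -(2 * α)) (q := -2 - 2 * α) (by linarith) (by linarith)
      ht hci ?_ ?_
    · refine le_trans (le_of_eq ?_) (mul_le_mul_of_nonneg_left hlow
        (show 0 ≤ 8 * (1 + 2 * α) * (1 + α) / 3 * C0 α by positivity))
      have e1 : t0 ^ (-3 / 2 - α) = t0 ^ (α - 1 / 2) * t0 ^ (-2 - 2 * α + 1) := by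
        rw [← Real.rpow_add ht]; congr 1; ring
      have e2 : t0 ^ (-(2 * α) + 1) = t0 ^ (-2 - 2 * α + 1) * t0 ^ 2 := by
        rw [← Real.rpow_natCast t0 2, ← Real.rpow_add ht]; congr 1; push_cast; ring
      have n1 : 1 - α * 2 ≠ 0 := by linarith
      have n2 : 1 + 2 * α ≠ 0 := by linarith
      rw [e1, e2, show -2 - 2 * α + 1 = -(1 + 2 * α) by ring, neg_div_neg_eq,
        show -(2 * α) + 1 = 1 - 2 * α by ring]
      field_simp
      ring
    · intro x hx hxt
      have h1 := le_of_convexOn_comp_sqrt ht hconv hx hxt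
      rw [hf0] at h1
      have h2 : t0 ^ (α - 1 / 2) / 2 / t0 ^ 2 * x ^ 2 ≤ 1 - f x := by
        have : t0 ^ (α - 1 / 2) / 2 / t0 ^ 2 * x ^ 2 ≤ (1 - f t0) / t0 ^ 2 * x ^ 2 := by gcongr
        refine this.trans ?_
        rw [← neg_sub (f t0) 1, neg_div]
        linarith
      rw [show -(2 * α) = -2 - 2 * α + (2 : ℕ) by push_cast; ring, Real.rpow_add_natCast hx.ne',
        mul_comm (x ^ _), ← mul_assoc]
      exact mul_le_mul_of_nonneg_right h2 (by positivity)
    · intro x hx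
      have hx0 := ht.trans hx
      have := hanti (mem_Ici.2 ht.le) (mem_Ici.2 hx0.le) hx.le
      exact mul_le_mul_of_nonneg_right (by linarith) (by positivity)
  · have hmono := setIntegral_mono_on hci hc1 measurableSet_Ioi hle
    rw [integral_one_sub_fl_mul_rpow hα0 hα1 hδ ht] at hmono
    have hbeta := integral_rpow_mul_one_add_sq_div_rpow (a := 1 / 2 - α) (b := δl + α + 1 / 2)
      (by linarith) (by linarith) ht
    rw [ProbabilityTheory.beta, show 1 / 2 - α + (δl + α + 1 / 2) = δl + 1 by ring,
      show 2 * (1 / 2 - α) - 1 = -(2 * α) by ring, hΓ,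
      show 2 * (1 / 2 - α) = -1 - 2 * α + (2 : ℕ) by push_cast; ring,
      Real.rpow_add_natCast ht.ne'] at hbeta
    rw [hbeta] at hmono
    refine (mul_le_mul_of_nonneg_left hmono
      (show 0 ≤ 8 * (1 + 2 * α) * (1 + α) / 3 * C0 α by positivity)).trans_eq ?_
    have n2 : 1 + 2 * α ≠ 0 := by linarith
    unfold cHigh
    field_simp

end GSQGhalfplane
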